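/- (Importance-weighted denoising score matching equivalence, first step of the proof of Theorem 1.) There exists a constant C′ ∈ ℝ, independent of s, such that for every measurable vector field s : ℝ^d → ℝ^d satisfying ∫ ‖s(x)‖² q_t(x) dx < ∞, one has ∫ ‖s(x) − ∇ log q_t(x)‖² q_t(x) dx = ∫∫ (q₀(x₀)/p₀(x₀)) · ‖s(x) − ∇_x log k(x₀, x)‖² k(x₀, x) p₀(x₀) dx₀ dx + C′. Hence score matching against the target marginal q_t coincides, up to an additive constant independent of s, with denoising score matching on the source domain reweighted by the density ratio q₀/p₀. -/

import Mathlib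

open MeasureTheory

noncomputable section

/-- `ℝ^d` with its Euclidean structure. -/
abbrev Euc (d : ℕ) := EuclideanSpace ℝ (Fin d)

/-- The logarithmic derivative formula for gradients; it holds without differentiability, since both
sides vanish where `f` is not differentiable. -/
theorem gradient_log_of_pos {E : Type*} [NormedAddCommGroup E] [InnerProductSpace ℝ E]
    [CompleteSpace E] {f : E → ℝ} (hf : ∀ y, 0 < f y) (x : E) :
    gradient (fun y => Real.log (f y)) x = (f x)⁻¹ • gradient f x := by
  by_cases h : DifferentiableAt ℝ f x
  · simp [gradient, fderiv.log h (hf x).ne']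
  · have h' : ¬ DifferentiableAt ℝ (fun y => Real.log (f y)) x := fun hl => h <| by
      simpa only [Real.exp_log (hf _)] using hl.exp
    simp [gradient, fderiv_zero_of_not_differentiableAt h, fderiv_zero_of_not_differentiableAt h']

theorem measurable_gradient {E : Type*} [NormedAddCommGroup E] [InnerProductSpace ℝ E]
    [CompleteSpace E] [MeasurableSpace E] [BorelSpace E] (f : E → ℝ) :
    Measurable (gradient f) :=
  (InnerProductSpace.toDual ℝ E).symm.continuous.measurable.comp (measurable_fderiv ℝ f)

/-- The gradient in the second variable, at a fixed point, of a function that is measurable in the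
parameter and differentiable in the second variable depends measurably on the parameter. -/
theorem measurable_gradient_param {α : Type*} [MeasurableSpace α] {d : ℕ} {k : α → Euc d → ℝ}
    (hk : ∀ x, Measurable fun a => k a x) (hd : ∀ a, Differentiable ℝ (k a)) (x : Euc d) :
    Measurable fun a => gradient (k a) x := by
  refine (WithLp.measurable_toLp 2 (Fin d → ℝ)).comp
    (g := WithLp.toLp 2) (f := fun a i => gradient (k a) x i) (measurable_pi_lambda _ fun i => ?_)
  have hlim : ∀ a, Filter.Tendsto
      (fun n : ℕ => (n : ℝ) • (k a (x + (n : ℝ)⁻¹ • EuclideanSpace.single i 1) - k a x))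
      Filter.atTop (nhds (gradient (k a) x i)) := fun a => by
    have h1 : gradient (k a) x i = fderiv ℝ (k a) x (EuclideanSpace.single i 1) := by
      rw [← InnerProductSpace.toDual_symm_apply, real_inner_comm]
      simp [gradient, EuclideanSpace.inner_single_left]
    rw [h1]
    exact (hd a x).hasFDerivAt.lim_real _ |>.comp tendsto_natCast_atTop_atTop
  refine measurable_of_tendsto_metrizable (fun n => ?_) (tendsto_pi_nhds.2 hlim)
  exact ((hk _).sub (hk _)).const_smul (n : ℝ)

section WeightedSquare

variable {α E : Type*} [MeasurableSpace α] {μ : Measure α} [NormedAddCommGroup E]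
  [InnerProductSpace ℝ E]

theorem two_mul_abs_real_inner_le (a b : E) : |2 * inner ℝ a b| ≤ ‖a‖ ^ 2 + ‖b‖ ^ 2 := by
  rw [abs_mul, abs_two]
  nlinarith [abs_real_inner_le_norm a b, two_mul_le_add_sq ‖a‖ ‖b‖]

theorem integrable_weighted_inner {w : α → ℝ} {F G : α → E} (hw0 : ∀ a, 0 ≤ w a)
    (hw : AEStronglyMeasurable w μ) (hF : AEStronglyMeasurable F μ)
    (hG : AEStronglyMeasurable G μ) (hFw : Integrable (fun a => ‖F a‖ ^ 2 * w a) μ)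
    (hGw : Integrable (fun a => ‖G a‖ ^ 2 * w a) μ) :
    Integrable (fun a => 2 * inner ℝ (F a) (G a) * w a) μ := by
  refine (hFw.add hGw).mono' (((hF.inner hG).const_mul 2).mul hw) (.of_forall fun a => ?_)
  rw [Real.norm_eq_abs, abs_mul, abs_of_nonneg (hw0 a), Pi.add_apply, ← add_mul]
  exact mul_le_mul_of_nonneg_right (two_mul_abs_real_inner_le _ _) (hw0 a)

theorem integrable_weight_smul {w : α → ℝ} {G : α → E} (hw0 : ∀ a, 0 ≤ w a)
    (hw : Integrable w μ) (hG : AEStronglyMeasurable G μ)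
    (hGw : Integrable (fun a => ‖G a‖ ^ 2 * w a) μ) : Integrable (fun a => w a • G a) μ := by
  refine (hw.add hGw).mono' (hw.aestronglyMeasurable.smul hG) (.of_forall fun a => ?_)
  rw [norm_smul, Real.norm_eq_abs, abs_of_nonneg (hw0 a), Pi.add_apply]
  nlinarith [mul_nonneg (hw0 a) (add_nonneg (sq_nonneg (‖G a‖ - 1)) (sq_nonneg ‖G a‖)),
    mul_nonneg (hw0 a) zero_le_one]

theorem integral_weighted_norm_sub_sq [CompleteSpace E] {w : α → ℝ} {G : α → E}
    (hw0 : ∀ a, 0 ≤ w a) (hw : Integrable w μ) (hG : AEStronglyMeasurable G μ)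
    (hGw : Integrable (fun a => ‖G a‖ ^ 2 * w a) μ) (v : E) :
    ∫ a, ‖v - G a‖ ^ 2 * w a ∂μ =
      ‖v‖ ^ 2 * ∫ a, w a ∂μ - 2 * inner ℝ v (∫ a, w a • G a ∂μ) + ∫ a, ‖G a‖ ^ 2 * w a ∂μ := by
  have hi := integrable_weight_smul hw0 hw hG hGw
  have hv : Integrable (fun a => 2 * inner ℝ v (w a • G a)) μ := (hi.const_inner v).const_mul 2
  have hvw : Integrable (fun a => ‖v‖ ^ 2 * w a) μ := hw.const_mul _
  rw [← integral_inner hi, ← integral_const_mul, ← integral_const_mul, ← integral_sub hvw hv,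
    ← integral_add (hvw.sub' hv) hGw]
  refine integral_congr_ae (.of_forall fun a => ?_)
  simp only [norm_sub_sq_real, real_inner_smul_right]
  ring

end WeightedSquare

/-- **Importance-weighted denoising score matching equivalence (first step of the proof
of Theorem 1).**
There exists a constant `C′ ∈ ℝ`, independent of `s`, such that for every measurable
vector field `s : ℝ^d → ℝ^d` with `∫ ‖s(x)‖² q_t(x) dx < ∞`,
`∫ ‖s(x) − ∇ log q_t(x)‖² q_t(x) dx
  = ∫∫ (q₀(x₀)/p₀(x₀)) ‖s(x) − ∇_x log k(x₀,x)‖² k(x₀,x) p₀(x₀) dx₀ dx + C′`.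
Hence score matching against the target marginal `q_t` coincides, up to an additive
constant independent of `s`, with denoising score matching on the source domain
reweighted by the density ratio `q₀/p₀`. -/
theorem importance_weighted_denoising_score_matching_equivalence
    (d : ℕ) (hd : 0 < d)
    (p₀ q₀ : Euc d → ℝ) (k : Euc d → Euc d → ℝ) (pt qt : Euc d → ℝ)
    (hp₀pos : ∀ x₀, 0 < p₀ x₀) (hq₀pos : ∀ x₀, 0 < q₀ x₀)
    (hp₀meas : Measurable p₀) (hq₀meas : Measurable q₀)
    (hp₀prob : ∫ x₀, p₀ x₀ = 1) (hq₀prob : ∫ x₀, q₀ x₀ = 1)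
    (hkpos : ∀ x₀ x, 0 < k x₀ x)
    (hkmeas : Measurable (Function.uncurry k))
    (hkprob : ∀ x₀, ∫ x, k x₀ x = 1)
    (hkdiff : ∀ x₀, Differentiable ℝ fun x => k x₀ x)
    (hpt_int : ∀ x, Integrable fun x₀ => k x₀ x * p₀ x₀)
    (hqt_int : ∀ x, Integrable fun x₀ => k x₀ x * q₀ x₀)
    (hpt : ∀ x, pt x = ∫ x₀, k x₀ x * p₀ x₀)
    (hqt : ∀ x, qt x = ∫ x₀, k x₀ x * q₀ x₀)
    (hpt_grad : ∀ x, gradient pt x = ∫ x₀, p₀ x₀ • gradient (fun y => k x₀ y) x)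
    (hqt_grad : ∀ x, gradient qt x = ∫ x₀, q₀ x₀ • gradient (fun y => k x₀ y) x)
    (hscore_sq_int :
      Integrable fun x => ‖gradient (fun y => Real.log (qt y)) x‖ ^ 2 * qt x)
    (hcond_sq_int :
      Integrable fun z : Euc d × Euc d =>
        (q₀ z.1 / p₀ z.1) *
          (‖gradient (fun y => Real.log (k z.1 y)) z.2‖ ^ 2 * (k z.1 z.2 * p₀ z.1))) :
    ∃ C' : ℝ, ∀ s : Euc d → Euc d, Measurable s →
      Integrable (fun x => ‖s x‖ ^ 2 * qt x) →
      ∫ x, ‖s x - gradient (fun y => Real.log (qt y)) x‖ ^ 2 * qt x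
        = (∫ x, ∫ x₀, (q₀ x₀ / p₀ x₀) *
            (‖s x - gradient (fun y => Real.log (k x₀ y)) x‖ ^ 2 * (k x₀ x * p₀ x₀)))
          + C' := by
  have hk2 : ∀ x, Measurable fun a => k a x := fun x =>
    hkmeas.comp (measurable_id.prodMk measurable_const)
  have hw0 : ∀ x x₀, 0 < k x₀ x * q₀ x₀ := fun x x₀ => mul_pos (hkpos _ _) (hq₀pos _)
  have hqtpos : ∀ x, 0 < qt x := fun x => by
    rw [hqt, integral_pos_iff_support_of_nonneg (fun x₀ => (hw0 x x₀).le) (hqt_int x),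
      Function.support_eq_univ fun x₀ => (hw0 x x₀).ne']
    exact Measure.measure_univ_pos.2 (NeZero.ne _)
  have hqtmeas : AEStronglyMeasurable qt := by
    rw [funext hqt]
    exact ((hkmeas.mul (hq₀meas.comp measurable_fst)).stronglyMeasurable.integral_prod_left'
      (μ := volume)).aestronglyMeasurable
  set L := gradient fun y => Real.log (qt y) with hL
  set G : Euc d → Euc d → Euc d := fun x x₀ => gradient (fun y => Real.log (k x₀ y)) x with hG
  have hLmeas : AEStronglyMeasurable L := (measurable_gradient _).aestronglyMeasurable
  have hGeq : ∀ x x₀, G x x₀ = (k x₀ x)⁻¹ • gradient (k x₀) x := fun x x₀ =>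
    gradient_log_of_pos (hkpos x₀) x
  have hGmeas : ∀ x, AEStronglyMeasurable (G x) := fun x => by
    rw [funext (hGeq x)]
    exact ((hk2 x).inv.smul (measurable_gradient_param hk2 hkdiff x)).aestronglyMeasurable
  have hratio : ∀ (x x₀ : Euc d) (c : ℝ),
      q₀ x₀ / p₀ x₀ * (c * (k x₀ x * p₀ x₀)) = c * (k x₀ x * q₀ x₀) := fun x x₀ c => by
    have := (hp₀pos x₀).ne'
    field_simp
  have hscore : ∀ x, ∫ x₀, (k x₀ x * q₀ x₀) • G x x₀ = qt x • L x := fun x => by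
    rw [hL, gradient_log_of_pos hqtpos, smul_inv_smul₀ (hqtpos x).ne', hqt_grad]
    refine integral_congr_ae (.of_forall fun x₀ => ?_)
    simp only [hGeq, smul_smul]
    congr 1
    have := (hkpos x₀ x).ne'
    field_simp
  have hcond : Integrable fun z : Euc d × Euc d => ‖G z.2 z.1‖ ^ 2 * (k z.1 z.2 * q₀ z.1) :=
    hcond_sq_int.congr (.of_forall fun z => hratio _ _ _)
  have hcond_int : Integrable fun x => ∫ x₀, ‖G x x₀‖ ^ 2 * (k x₀ x * q₀ x₀) :=
    hcond.integral_prod_right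
  refine ⟨(∫ x, ‖L x‖ ^ 2 * qt x) - ∫ x, ∫ x₀, ‖G x x₀‖ ^ 2 * (k x₀ x * q₀ x₀), fun s hs hsq => ?_⟩
  have hcross : Integrable fun x => 2 * inner ℝ (s x) (L x) * qt x :=
    integrable_weighted_inner (fun x => (hqtpos x).le) hqtmeas hs.aestronglyMeasurable hLmeas
      hsq hscore_sq_int
  have hleft : ∫ x, ‖s x - L x‖ ^ 2 * qt x =
      (∫ x, (‖s x‖ ^ 2 * qt x - 2 * inner ℝ (s x) (L x) * qt x)) + ∫ x, ‖L x‖ ^ 2 * qt x := by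
    rw [← integral_add (hsq.sub' hcross) hscore_sq_int]
    refine integral_congr_ae (.of_forall fun x => ?_)
    simp only [norm_sub_sq_real]
    ring
  have hright : ∫ x, ∫ x₀, q₀ x₀ / p₀ x₀ * (‖s x - G x x₀‖ ^ 2 * (k x₀ x * p₀ x₀)) =
      (∫ x, (‖s x‖ ^ 2 * qt x - 2 * inner ℝ (s x) (L x) * qt x)) +
        ∫ x, ∫ x₀, ‖G x x₀‖ ^ 2 * (k x₀ x * q₀ x₀) := by
    rw [← integral_add (hsq.sub' hcross) hcond_int]
    refine integral_congr_ae ?_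
    filter_upwards [hcond.prod_left_ae] with x hx
    simp only [hratio]
    rw [integral_weighted_norm_sub_sq (fun x₀ => (hw0 x x₀).le) (hqt_int x) (hGmeas x) hx,
      hscore, ← hqt, real_inner_smul_right]
    ring
  rw [hleft, hright]
  ring
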